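/- Let f ∈ F[x,y] be a polynomial with LM_≺(f) = x^{μ} y^{λ}. Then x^{q^2} - x and y^{q^2} - y both belong to the ideal ⟨H, f⟩ if and only if there exists a subset D ⊆ E with ⟨H, f⟩ = I_D, |D| = d, and such that D is the support of a nonzero codeword of C_m of minimum weight d. -/

import Mathlib

open MvPolynomial

noncomputable section

/-- The monomial `x^r y^s` in `F[x,y]`, where `x = X 0`, `y = X 1`. -/
def monoXY (F : Type) [Field F] (r s : ℕ) : MvPolynomial (Fin 2) F := X 0 ^ r * X 1 ^ s

/-- The Hermitian polynomial `H = x^(q+1) - y^q - y`. -/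
def Hpoly (F : Type) [Field F] (q : ℕ) : MvPolynomial (Fin 2) F :=
  X 0 ^ (q + 1) - X 1 ^ q - X 1

/-- Evaluation of a bivariate polynomial at a point of `F × F`. -/
def evalPt {F : Type} [Field F] (p : F × F) (f : MvPolynomial (Fin 2) F) : F :=
  MvPolynomial.eval ![p.1, p.2] f

/-- The vanishing ideal of a set of points `S ⊆ F × F`. -/
def vanIdeal (F : Type) [Field F] (S : Set (F × F)) : Ideal (MvPolynomial (Fin 2) F) where
  carrier := {f | ∀ p ∈ S, evalPt p f = 0}
  add_mem' := by
    intro a b ha hb p hp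
    have h1 := ha p hp
    have h2 := hb p hp
    simp only [evalPt] at h1 h2 ⊢
    simp [map_add, h1, h2]
  zero_mem' := by
    intro p hp
    simp [evalPt]
  smul_mem' := by
    intro c f hf p hp
    have h1 := hf p hp
    simp only [evalPt] at h1 ⊢
    simp [smul_eq_mul, map_mul, h1]

/-- The `DegRevLex` order with `y > x`, on exponent pairs `(a, b) ↔ x^a y^b`. -/
def precOrd : ℕ × ℕ → ℕ × ℕ → Prop := fun a b =>
  a.1 + a.2 < b.1 + b.2 ∨ (a.1 + a.2 = b.1 + b.2 ∧ a.2 < b.2)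

/-- The pair of exponents `(d 0, d 1)` of an exponent finsupp. -/
def expPair (d : Fin 2 →₀ ℕ) : ℕ × ℕ := (d 0, d 1)

/-- `x^r y^s` is the leading monomial of `f` with respect to the monomial order `lt`. -/
def IsLMwith {F : Type} [Field F] (lt : ℕ × ℕ → ℕ × ℕ → Prop)
    (f : MvPolynomial (Fin 2) F) (r s : ℕ) : Prop :=
  MvPolynomial.coeff (Finsupp.single 0 r + Finsupp.single 1 s) f ≠ 0 ∧
    ∀ d ∈ f.support, expPair d = (r, s) ∨ lt (expPair d) (r, s)

/-- The initial ideal of `I` w.r.t. the monomial order `lt`: the ideal generated by the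
leading monomials of the nonzero elements of `I`. -/
def initialIdealWith {F : Type} [Field F] (lt : ℕ × ℕ → ℕ × ℕ → Prop)
    (I : Ideal (MvPolynomial (Fin 2) F)) : Ideal (MvPolynomial (Fin 2) F) :=
  Ideal.span {g | ∃ f ∈ I, f ≠ 0 ∧ ∃ r s, IsLMwith lt f r s ∧ g = monoXY F r s}

/-- The set `E` of `F`-rational affine points of the Hermitian curve. -/
def Eset (F : Type) [Field F] (q : ℕ) : Set (F × F) :=
  {p | p.1 ^ (q + 1) = p.2 ^ q + p.2}

/-- The set `B` of (exponent pairs of) monomials. -/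
def Bset (q : ℕ) : Set (ℕ × ℕ) :=
  {p | (p.1 ≤ q ∧ p.2 ≤ q ^ 2 - q - 1) ∨ (p.1 = 0 ∧ q ^ 2 - q ≤ p.2 ∧ p.2 ≤ q ^ 2 - 1)}

/-- The Hermitian code `C_m` (as a set of vectors), for the enumeration `P` of `E`. -/
def codeSet (F : Type) [Field F] (q m : ℕ) (P : Fin (q ^ 3) → F × F) :
    Set (Fin (q ^ 3) → F) :=
  {c | ∀ r s : ℕ, r * q + s * (q + 1) ≤ m → ∑ i, c i * ((P i).1 ^ r * (P i).2 ^ s) = 0}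

/-- The weight of a codeword: the number of nonzero entries. -/
def wt {F : Type} [Field F] {n : ℕ} (c : Fin n → F) : ℕ := {i | c i ≠ 0}.ncard

/-- The support of a codeword, as a set of points of the curve. -/
def suppPts {F : Type} [Field F] {n : ℕ} (P : Fin n → F × F) (c : Fin n → F) :
    Set (F × F) :=
  P '' {i | c i ≠ 0}

end

section Grading

variable {F : Type} [Field F]

theorem monoXY_mul (r s r' s' : ℕ) :
    monoXY F r s * monoXY F r' s' = monoXY F (r + r') (s + s') := by
  simp only [monoXY]; ring

theorem evalPt_monoXY (p : F × F) (r s : ℕ) : evalPt p (monoXY F r s) = p.1 ^ r * p.2 ^ s := by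
  simp [evalPt, monoXY]

theorem eq_sum_smul_monoXY (f : MvPolynomial (Fin 2) F) :
    f = ∑ e ∈ f.support, coeff e f • monoXY F (e 0) (e 1) := by
  conv_lhs => rw [f.as_sum]
  refine Finset.sum_congr rfl fun e _ => ?_
  rw [monomial_eq, smul_eq_C_mul, monoXY, Finsupp.prod_fintype _ _ (by simp)]
  simp

/-- The substitution `x ↦ x t^q`, `y ↦ y t^(q+1)`, whose degree in `t` is the weighted degree. -/
noncomputable def weightHom (F : Type) [Field F] (q : ℕ) :
    MvPolynomial (Fin 2) F →ₐ[F] Polynomial (MvPolynomial (Fin 2) F) :=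
  aeval ![Polynomial.C (X 0) * Polynomial.X ^ q, Polynomial.C (X 1) * Polynomial.X ^ (q + 1)]

theorem weightHom_monoXY (q r s : ℕ) : weightHom F q (monoXY F r s) =
    Polynomial.C (monoXY F r s) * Polynomial.X ^ (r * q + s * (q + 1)) := by
  simp only [weightHom, monoXY, map_mul, map_pow, aeval_X, Matrix.cons_val_zero,
    Matrix.cons_val_one]
  ring

/-- The polynomials of weighted degree at most `k`. -/
noncomputable def weightLE (F : Type) [Field F] (q k : ℕ) :
    Submodule F (MvPolynomial (Fin 2) F) where
  carrier := {h | (weightHom F q h).natDegree ≤ k}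
  add_mem' {a b} ha hb := by
    simp only [Set.mem_ofPred_eq, map_add] at *
    exact Polynomial.natDegree_add_le_of_degree_le ha hb
  zero_mem' := by simp
  smul_mem' c h hh := by
    simp only [Set.mem_ofPred_eq, map_smul] at *
    exact (Polynomial.natDegree_smul_le _ _).trans hh

theorem mem_weightLE {q k : ℕ} {h : MvPolynomial (Fin 2) F} :
    h ∈ weightLE F q k ↔ (weightHom F q h).natDegree ≤ k := Iff.rfl

theorem weightLE_mono {q k l : ℕ} (hkl : k ≤ l) : weightLE F q k ≤ weightLE F q l :=
  fun _ hh => le_trans hh hkl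

theorem monoXY_mem_weightLE {q r s k : ℕ} (h : r * q + s * (q + 1) ≤ k) :
    monoXY F r s ∈ weightLE F q k := by
  rw [mem_weightLE, weightHom_monoXY]
  exact (Polynomial.natDegree_C_mul_X_pow_le _ _).trans h

theorem mul_mem_weightLE {q k l : ℕ} {g h : MvPolynomial (Fin 2) F}
    (hg : g ∈ weightLE F q k) (hh : h ∈ weightLE F q l) : g * h ∈ weightLE F q (k + l) := by
  rw [mem_weightLE, map_mul]
  exact Polynomial.natDegree_mul_le_of_le hg hh

/-- The sum of the coefficients of the monomials of weighted degree `k`. -/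
noncomputable def coeffSum (F : Type) [Field F] (q k : ℕ) : MvPolynomial (Fin 2) F →ₗ[F] F :=
  (aeval (fun _ => (1 : F)) : MvPolynomial (Fin 2) F →ₐ[F] F).toLinearMap ∘ₗ
    ((Polynomial.lcoeff (MvPolynomial (Fin 2) F) k).restrictScalars F) ∘ₗ
      (weightHom F q).toLinearMap

theorem coeffSum_apply (q k : ℕ) (h : MvPolynomial (Fin 2) F) :
    coeffSum F q k h = aeval (fun _ => (1 : F)) ((weightHom F q h).coeff k) := rfl

theorem coeffSum_of_mem_weightLE {q k l : ℕ} (hkl : k < l) {h : MvPolynomial (Fin 2) F}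
    (hh : h ∈ weightLE F q k) : coeffSum F q l h = 0 := by
  rw [coeffSum_apply, Polynomial.coeff_eq_zero_of_natDegree_lt (lt_of_le_of_lt hh hkl), map_zero]

theorem coeffSum_monoXY {q r s k : ℕ} (h : r * q + s * (q + 1) = k) :
    coeffSum F q k (monoXY F r s) = 1 := by
  subst h
  rw [coeffSum_apply, weightHom_monoXY, Polynomial.coeff_C_mul_X_pow, if_pos rfl]
  simp [monoXY]

theorem coeffSum_mul {q k l : ℕ} {g h : MvPolynomial (Fin 2) F}
    (hg : g ∈ weightLE F q k) (hh : h ∈ weightLE F q l) :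
    coeffSum F q (k + l) (g * h) = coeffSum F q k g * coeffSum F q l h := by
  simp only [coeffSum_apply, map_mul, Polynomial.coeff_mul_add_eq_of_natDegree_le hg hh]

theorem Hpoly_eq_monoXY (q : ℕ) :
    Hpoly F q = monoXY F (q + 1) 0 - monoXY F 0 q - monoXY F 0 1 := by
  simp [Hpoly, monoXY]

theorem coeff_weightHom_Hpoly (q : ℕ) (hq : 2 ≤ q) :
    (weightHom F q (Hpoly F q)).coeff (q * (q + 1)) = monoXY F (q + 1) 0 - monoXY F 0 q := by
  have h1 : q * (q + 1) ≠ 0 * q + 1 * (q + 1) := by nlinarith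
  have h2 : q * (q + 1) = 0 * q + q * (q + 1) := by ring
  have h3 : q * (q + 1) = (q + 1) * q + 0 * (q + 1) := by ring
  rw [Hpoly_eq_monoXY, map_sub, map_sub, weightHom_monoXY, weightHom_monoXY, weightHom_monoXY,
    Polynomial.coeff_sub, Polynomial.coeff_sub, Polynomial.coeff_C_mul_X_pow,
    Polynomial.coeff_C_mul_X_pow, Polynomial.coeff_C_mul_X_pow, if_pos h3, if_pos h2, if_neg h1,
    sub_zero]

theorem Hpoly_mem_weightLE (q : ℕ) (hq : 2 ≤ q) : Hpoly F q ∈ weightLE F q (q * (q + 1)) := by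
  rw [Hpoly_eq_monoXY]
  exact sub_mem (sub_mem (monoXY_mem_weightLE (by nlinarith)) (monoXY_mem_weightLE (by nlinarith)))
    (monoXY_mem_weightLE (by nlinarith))

theorem natDegree_weightHom_Hpoly (q : ℕ) (hq : 2 ≤ q) :
    (weightHom F q (Hpoly F q)).natDegree = q * (q + 1) := by
  refine le_antisymm (Hpoly_mem_weightLE q hq) (Polynomial.le_natDegree_of_ne_zero ?_)
  rw [coeff_weightHom_Hpoly q hq]
  intro h
  have := congrArg (evalPt ((1 : F), (0 : F))) h
  simp only [evalPt, map_sub] at this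
  simp [monoXY, show q ≠ 0 by omega] at this

/-- In the ideal generated by `H`, the leading weight component has coefficient sum zero. -/
theorem coeffSum_eq_zero_of_mem_span_Hpoly {q k : ℕ} (hq : 2 ≤ q) {h : MvPolynomial (Fin 2) F}
    (hh : h ∈ Ideal.span {Hpoly F q}) (hk : h ∈ weightLE F q k) : coeffSum F q k h = 0 := by
  obtain ⟨g, rfl⟩ := Ideal.mem_span_singleton'.1 hh
  by_cases hg : weightHom F q g = 0
  · simp [coeffSum_apply, hg]
  have hH : weightHom F q (Hpoly F q) ≠ 0 := by
    intro h0
    have := natDegree_weightHom_Hpoly (F := F) q hq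
    rw [h0, Polynomial.natDegree_zero] at this
    nlinarith
  have hdeg := hk
  rw [mem_weightLE, map_mul, Polynomial.natDegree_mul hg hH, natDegree_weightHom_Hpoly q hq]
    at hdeg
  obtain ⟨l, rfl⟩ := Nat.exists_eq_add_of_le' (le_of_add_le_right hdeg)
  rw [coeffSum_mul (by rw [mem_weightLE]; omega) (Hpoly_mem_weightLE q hq),
    coeffSum_apply _ (q * (q + 1)), coeff_weightHom_Hpoly q hq]
  simp [monoXY]

/-- Weights of monomials with `x`-exponent at most `q` are distinct. -/
theorem weight_injOn {q : ℕ} {a b a' b' : ℕ} (ha : a ≤ q) (ha' : a' ≤ q)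
    (h : a * q + b * (q + 1) = a' * q + b' * (q + 1)) : a = a' ∧ b = b' := by
  have key : ∀ {a b a' b' : ℕ}, a ≤ q → a' ≤ q →
      a * q + b * (q + 1) = a' * q + b' * (q + 1) → a ≤ a' := by
    intro a b a' b' ha ha' h
    by_contra! hlt
    obtain ⟨c, rfl⟩ := Nat.exists_eq_add_of_lt hlt
    have hb : b < b' := by nlinarith
    obtain ⟨e, rfl⟩ := Nat.exists_eq_add_of_lt hb
    have h1 : (c + 1) * q = (e + 1) * (q + 1) := by nlinarith
    have hdvd : q + 1 ∣ c + 1 :=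
      (Nat.Coprime.dvd_mul_right (by simp)).1 (Dvd.intro_left _ h1.symm)
    have := Nat.le_of_dvd (by omega) hdvd
    omega
  obtain rfl := le_antisymm (key ha ha' h) (key ha' ha h.symm)
  exact ⟨rfl, Nat.eq_of_mul_eq_mul_right (by omega) (by omega : b * (q + 1) = b' * (q + 1))⟩

/-- A nontrivial combination of monomials with `x`-exponent at most `q` has a leading one. -/
theorem exists_leading_of_sum {q : ℕ} (S : Finset (ℕ × ℕ)) (hS : ∀ i ∈ S, i.1 ≤ q)
    (c : ℕ × ℕ → F) (hc : ∃ i ∈ S, c i ≠ 0) :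
    ∃ i ∈ S, c i ≠ 0 ∧
      ∑ j ∈ S, c j • monoXY F j.1 j.2 ∈ weightLE F q (i.1 * q + i.2 * (q + 1)) ∧
      coeffSum F q (i.1 * q + i.2 * (q + 1)) (∑ j ∈ S, c j • monoXY F j.1 j.2) = c i := by
  classical
  obtain ⟨i, hi, hmax⟩ := (S.filter (c · ≠ 0)).exists_max_image
    (fun i => i.1 * q + i.2 * (q + 1)) (by
      obtain ⟨i, hi, h0⟩ := hc
      exact ⟨i, Finset.mem_filter.2 ⟨hi, h0⟩⟩)
  rw [Finset.mem_filter] at hi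
  refine ⟨i, hi.1, hi.2, Submodule.sum_mem _ fun j hj => ?_, ?_⟩
  · by_cases h0 : c j = 0
    · simp [h0]
    · exact Submodule.smul_mem _ _ (monoXY_mem_weightLE (hmax j (Finset.mem_filter.2 ⟨hj, h0⟩)))
  · rw [map_sum, Finset.sum_eq_single_of_mem i hi.1]
    · simp [coeffSum_monoXY]
    · intro j hj hji
      by_cases h0 : c j = 0
      · simp [h0]
      have hlt := lt_of_le_of_ne (hmax j (Finset.mem_filter.2 ⟨hj, h0⟩)) (fun h => hji (by
        obtain ⟨h1, h2⟩ := weight_injOn (hS j hj) (hS i hi.1) h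
        exact Prod.ext h1 h2))
      rw [map_smul, coeffSum_of_mem_weightLE hlt (monoXY_mem_weightLE le_rfl), smul_zero]

theorem monoXY_reduce (q r s : ℕ) : monoXY F (r + (q + 1)) s =
    monoXY F r s * Hpoly F q + monoXY F r (s + q) + monoXY F r (s + 1) := by
  simp only [monoXY, Hpoly]; ring

/-- Modulo `H`, every polynomial is a combination of monomials with `x`-exponent at most `q`. -/
theorem exists_reduced (q : ℕ) (g : MvPolynomial (Fin 2) F) :
    ∃ (S : Finset (ℕ × ℕ)) (c : ℕ × ℕ → F), (∀ i ∈ S, i.1 ≤ q) ∧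
      g - ∑ j ∈ S, c j • monoXY F j.1 j.2 ∈ Ideal.span {Hpoly F q} := by
  set N : Submodule F (MvPolynomial (Fin 2) F) :=
    Submodule.span F ((fun i : ℕ × ℕ => monoXY F i.1 i.2) '' {i | i.1 ≤ q})
  have hmono : ∀ r s, monoXY F r s ∈ (Ideal.span {Hpoly F q}).restrictScalars F ⊔ N := by
    intro r
    induction r using Nat.strong_induction_on with
    | _ r ih =>
      intro s
      by_cases hr : r ≤ q
      · exact Submodule.mem_sup_right (Submodule.subset_span ⟨(r, s), hr, rfl⟩)
      · obtain ⟨r, rfl⟩ := Nat.exists_eq_add_of_le' (show q + 1 ≤ r by omega)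
        rw [monoXY_reduce]
        refine add_mem (add_mem (Submodule.mem_sup_left ?_) (ih _ (by omega) _))
          (ih _ (by omega) _)
        exact Ideal.mul_mem_left _ _ (Ideal.mem_span_singleton_self _)
  have hg : g ∈ (Ideal.span {Hpoly F q}).restrictScalars F ⊔ N := by
    rw [eq_sum_smul_monoXY g]
    exact Submodule.sum_mem _ fun e _ => Submodule.smul_mem _ _ (hmono _ _)
  obtain ⟨h, hh, n, hn, rfl⟩ := Submodule.mem_sup.1 hg
  obtain ⟨c, hc, rfl⟩ := (Finsupp.mem_span_image_iff_linearCombination F).1 hn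
  refine ⟨c.support, c, fun i hi => (Finsupp.mem_supported F c).1 hc hi, ?_⟩
  rw [Finsupp.linearCombination_apply, Finsupp.sum, add_sub_cancel_right]
  exact hh

/-- The weight of the leading monomial of `f` exceeds that of all other monomials. -/
theorem weight_lt_of_isLM {q μ lam : ℕ} (hμ : μ ≤ q) {f : MvPolynomial (Fin 2) F}
    (hlm : IsLMwith precOrd f μ lam) {e : Fin 2 →₀ ℕ} (he : e ∈ f.support)
    (hne : e ≠ Finsupp.single 0 μ + Finsupp.single 1 lam) :
    e 0 * q + e 1 * (q + 1) < μ * q + lam * (q + 1) := by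
  rcases hlm.2 e he with h | h
  · refine absurd ?_ hne
    simp only [expPair, Prod.mk.injEq] at h
    ext i
    fin_cases i <;> simp [h.1, h.2]
  · simp only [expPair, precOrd] at h
    rcases h with h | ⟨h, h'⟩
    · nlinarith [Nat.mul_le_mul_right q (show e 0 + e 1 + 1 ≤ μ + lam from h)]
    · nlinarith [congrArg (· * q) h]

theorem exists_leading_of_isLM {q μ lam : ℕ} (hμ : μ ≤ q) {f : MvPolynomial (Fin 2) F}
    (hlm : IsLMwith precOrd f μ lam) :
    ∃ c : F, c ≠ 0 ∧ ∃ T : Finset (Fin 2 →₀ ℕ),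
      (∀ e ∈ T, e 0 * q + e 1 * (q + 1) < μ * q + lam * (q + 1)) ∧
      f = c • monoXY F μ lam + ∑ e ∈ T, coeff e f • monoXY F (e 0) (e 1) := by
  classical
  refine ⟨_, hlm.1, f.support.erase (Finsupp.single 0 μ + Finsupp.single 1 lam), ?_, ?_⟩
  · intro e he
    rw [Finset.mem_erase] at he
    exact weight_lt_of_isLM hμ hlm he.2 he.1
  · conv_lhs => rw [eq_sum_smul_monoXY f]
    rw [← Finset.add_sum_erase _ _ (mem_support_iff.2 hlm.1)]
    simp

end Grading

section Footprint

variable {F : Type} [Field F]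

/-- The exponents of the monomials outside the initial ideal of `⟨H, f⟩`, with respect to the
weighted order, when `f` has leading monomial `x^μ y^lam`. -/
def footprint (q μ lam : ℕ) : Finset (ℕ × ℕ) :=
  Finset.range (q + 1) ×ˢ Finset.range lam ∪ Finset.range μ ×ˢ Finset.Ico lam (lam + q)

theorem mem_footprint {q μ lam : ℕ} {p : ℕ × ℕ} : p ∈ footprint q μ lam ↔
    (p.1 ≤ q ∧ p.2 < lam) ∨ (p.1 < μ ∧ lam ≤ p.2 ∧ p.2 < lam + q) := by
  simp [footprint]

theorem card_footprint (q μ lam : ℕ) :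
    (footprint q μ lam).card = μ * q + lam * (q + 1) := by
  rw [footprint, Finset.card_union_of_disjoint]
  · simp only [Finset.card_product, Finset.card_range, Nat.card_Ico, Nat.add_sub_cancel_left]
    ring
  · rw [Finset.disjoint_left]
    intro p hp hp'
    simp only [Finset.mem_product, Finset.mem_range, Finset.mem_Ico] at hp hp'
    omega

theorem le_of_mem_footprint {q μ lam : ℕ} (hμ : μ ≤ q) {p : ℕ × ℕ}
    (hp : p ∈ footprint q μ lam) : p.1 ≤ q := by
  rw [mem_footprint] at hp
  omega

/-- The weights of the footprint are symmetric. -/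
theorem exists_complement_of_mem_footprint {q μ lam N : ℕ} (hμ : μ ≤ q)
    (hN : N + q + 1 = μ * q + lam * (q + 1) + q * q) {p : ℕ × ℕ}
    (hp : p ∈ footprint q μ lam) :
    ∃ r s, (p.1 * q + p.2 * (q + 1)) + (r * q + s * (q + 1)) = N := by
  obtain ⟨a, b⟩ := p
  rw [mem_footprint] at hp
  dsimp only at hp ⊢
  by_cases ha : a < μ
  · obtain ⟨u, hu⟩ := Nat.exists_eq_add_of_lt ha
    obtain ⟨v, hv⟩ := Nat.exists_eq_add_of_lt (show b < lam + q by omega)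
    refine ⟨u, v, ?_⟩
    have hv' := congrArg (· * (q + 1)) hv
    subst hu
    nlinarith
  · obtain ⟨u, hu⟩ := Nat.exists_eq_add_of_le (show a ≤ q + μ by omega)
    obtain ⟨v, rfl⟩ := Nat.exists_eq_add_of_lt (show b < lam by omega)
    refine ⟨u, v, ?_⟩
    have hu' := congrArg (· * q) hu
    nlinarith

/-- The Frobenius number of the semigroup generated by `q` and `q + 1`. -/
theorem weight_add_ne {q : ℕ} (hq : 2 ≤ q) (a b : ℕ) : a * q + b * (q + 1) + q + 1 ≠ q * q := by
  intro h
  have h1 : q ∣ b + 1 := by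
    have : q ∣ (a + b + 1) * q + (b + 1) := by
      rw [show (a + b + 1) * q + (b + 1) = q * q by linarith]
      exact Dvd.intro _ rfl
    exact (Nat.dvd_add_right (Dvd.intro_left _ rfl)).1 this
  have := Nat.le_of_dvd (by omega) h1
  nlinarith

/-- Elements of `⟨H, f⟩` have no leading component in the top weight of the footprint. -/
theorem coeffSum_eq_zero_of_mem_span {q μ lam N : ℕ} (hq : 2 ≤ q) (hμ : μ ≤ q)
    (hN : N + q + 1 = μ * q + lam * (q + 1) + q * q)
    {f : MvPolynomial (Fin 2) F} (hlm : IsLMwith precOrd f μ lam)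
    {h : MvPolynomial (Fin 2) F} (hh : h ∈ Ideal.span {Hpoly F q, f}) (hk : h ∈ weightLE F q N) :
    coeffSum F q N h = 0 := by
  obtain ⟨c, hc, T, hT, hf⟩ := exists_leading_of_isLM hμ hlm
  set d := μ * q + lam * (q + 1) with hd
  have hfT : ∀ e ∈ T, coeff e f • monoXY F (e 0) (e 1) ∈ weightLE F q d := fun e he =>
    Submodule.smul_mem _ _ (monoXY_mem_weightLE (hT e he).le)
  have hfd : f ∈ weightLE F q d := by
    rw [hf]
    exact add_mem (Submodule.smul_mem _ _ (monoXY_mem_weightLE le_rfl)) (Submodule.sum_mem _ hfT)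
  have hfc : coeffSum F q d f = c := by
    rw [hf, map_add, map_smul, coeffSum_monoXY rfl, map_sum, Finset.sum_eq_zero]
    · simp
    · intro e he
      rw [map_smul, coeffSum_of_mem_weightLE (hT e he) (monoXY_mem_weightLE le_rfl), smul_zero]
  obtain ⟨g', g, rfl⟩ := Ideal.mem_span_pair.1 hh
  obtain ⟨S, a, hS, hga⟩ := exists_reduced q g
  set r := ∑ j ∈ S, a j • monoXY F j.1 j.2 with hr
  have hmem : g' * Hpoly F q + g * f - f * r ∈ Ideal.span {Hpoly F q} := by
    rw [show g' * Hpoly F q + g * f - f * r = g' * Hpoly F q + f * (g - r) by ring]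
    exact add_mem (Ideal.mul_mem_left _ _ (Ideal.mem_span_singleton_self _))
      (Ideal.mul_mem_left _ _ hga)
  set h := g' * Hpoly F q + g * f with hh_def
  by_cases ha : ∃ i ∈ S, a i ≠ 0
  · obtain ⟨i, hi, hi0, hrw, hrc⟩ := exists_leading_of_sum S hS a ha
    rw [← hr] at hrw hrc
    set s := i.1 * q + i.2 * (q + 1) with hs
    have hfr := mul_mem_weightLE hfd hrw
    have hfrc : coeffSum F q (d + s) (f * r) = c * a i := by
      rw [coeffSum_mul hfd hrw, hfc, hrc]
    rcases lt_trichotomy (d + s) N with hlt | heq | hgt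
    · have := coeffSum_eq_zero_of_mem_span_Hpoly hq hmem
        (sub_mem hk (weightLE_mono hlt.le hfr))
      rwa [map_sub, coeffSum_of_mem_weightLE hlt hfr, sub_zero] at this
    · exact absurd (by omega) (weight_add_ne hq i.1 i.2)
    · have := coeffSum_eq_zero_of_mem_span_Hpoly hq hmem
        (sub_mem (weightLE_mono hgt.le hk) hfr)
      rw [map_sub, coeffSum_of_mem_weightLE hgt hk, hfrc, zero_sub, neg_eq_zero] at this
      exact absurd this (mul_ne_zero hc hi0)
  · have hr0 : r = 0 := by
      push Not at ha
      exact Finset.sum_eq_zero fun j hj => by rw [ha j hj, zero_smul]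
    rw [hr0, mul_zero, sub_zero] at hmem
    exact coeffSum_eq_zero_of_mem_span_Hpoly hq hmem hk

/-- Multiplying a footprint combination by a suitable monomial moves its leading term to the top
weight. -/
theorem exists_mul_monoXY_leading {q μ lam N : ℕ} (hμ : μ ≤ q)
    (hN : N + q + 1 = μ * q + lam * (q + 1) + q * q) {c : ℕ × ℕ → F}
    (hc : ∃ i ∈ footprint q μ lam, c i ≠ 0) :
    ∃ r s, (∑ j ∈ footprint q μ lam, c j • monoXY F j.1 j.2) * monoXY F r s ∈ weightLE F q N ∧
      coeffSum F q N
        ((∑ j ∈ footprint q μ lam, c j • monoXY F j.1 j.2) * monoXY F r s) ≠ 0 := by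
  obtain ⟨i, hi, hi0, hw, hs⟩ :=
    exists_leading_of_sum (footprint q μ lam) (fun i hi => le_of_mem_footprint hμ hi) c hc
  obtain ⟨r, s, rfl⟩ := exists_complement_of_mem_footprint hμ hN hi
  refine ⟨r, s, mul_mem_weightLE hw (monoXY_mem_weightLE le_rfl), ?_⟩
  rwa [coeffSum_mul hw (monoXY_mem_weightLE le_rfl), hs, coeffSum_monoXY rfl, mul_one]

/-- Footprint monomials are linearly independent modulo `⟨H, f⟩`. -/
theorem eq_zero_of_footprint_sum_mem {q μ lam : ℕ} (hq : 2 ≤ q) (hμ : μ ≤ q)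
    {f : MvPolynomial (Fin 2) F} (hlm : IsLMwith precOrd f μ lam) {c : ℕ × ℕ → F}
    (hc : ∑ j ∈ footprint q μ lam, c j • monoXY F j.1 j.2 ∈ Ideal.span {Hpoly F q, f}) :
    ∀ i ∈ footprint q μ lam, c i = 0 := by
  by_contra! hne
  obtain ⟨N, hN⟩ := Nat.exists_eq_add_of_le'
    (show q + 1 ≤ μ * q + lam * (q + 1) + q * q by nlinarith)
  obtain ⟨r, s, hw, hs⟩ := exists_mul_monoXY_leading hμ (N := N) (by omega) hne
  exact hs (coeffSum_eq_zero_of_mem_span hq hμ (by omega) hlm (Ideal.mul_mem_right _ _ hc) hw)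

/-- Footprint monomials span modulo `⟨H, f⟩`. -/
theorem exists_footprint_sum_sub_mem {q μ lam : ℕ} (hq : 2 ≤ q) (hμ : μ ≤ q)
    {f : MvPolynomial (Fin 2) F} (hlm : IsLMwith precOrd f μ lam) (g : MvPolynomial (Fin 2) F) :
    ∃ c : ℕ × ℕ → F,
      g - ∑ j ∈ footprint q μ lam, c j • monoXY F j.1 j.2 ∈ Ideal.span {Hpoly F q, f} := by
  obtain ⟨c, hc, T, hT, hf⟩ := exists_leading_of_isLM hμ hlm
  set J := Ideal.span {Hpoly F q, f} with hJ
  have hHJ : Hpoly F q ∈ J := Ideal.subset_span (by simp)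
  have hfJ : f ∈ J := Ideal.subset_span (by simp)
  set W : Submodule F (MvPolynomial (Fin 2) F) := J.restrictScalars F ⊔
    Submodule.span F ((fun i : ℕ × ℕ => monoXY F i.1 i.2) '' (footprint q μ lam)) with hW
  have hJW : ∀ h ∈ J, h ∈ W := fun h hh => Submodule.mem_sup_left hh
  have hmono : ∀ k a b, a * q + b * (q + 1) = k → monoXY F a b ∈ W := by
    intro k
    induction k using Nat.strong_induction_on with
    | _ k ihk =>
      have hmulf : ∀ u v, (μ + u) * q + (lam + v) * (q + 1) ≤ k →
          monoXY F (μ + u) (lam + v) ∈ W := by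
        intro u v huv
        have hsum : ∑ e ∈ T, coeff e f • monoXY F (e 0 + u) (e 1 + v) ∈ W := by
          refine Submodule.sum_mem _ fun e he => Submodule.smul_mem _ _ (ihk _ ?_ _ _ rfl)
          have := hT e he
          nlinarith
        have heq : c • monoXY F (μ + u) (lam + v) =
            f * monoXY F u v - ∑ e ∈ T, coeff e f • monoXY F (e 0 + u) (e 1 + v) := by
          conv_rhs => rw [congrArg (· * monoXY F u v) hf]
          simp only [add_mul, Finset.sum_mul, smul_mul_assoc, monoXY_mul, add_sub_cancel_right]
        rw [← Submodule.smul_mem_iff _ hc, heq]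
        exact sub_mem (hJW _ (Ideal.mul_mem_right _ _ hfJ)) hsum
      intro a
      induction a using Nat.strong_induction_on with
      | _ a iha =>
        intro b hab
        by_cases haq : a ≤ q
        · by_cases hfoot : (a, b) ∈ footprint q μ lam
          · exact Submodule.mem_sup_right (Submodule.subset_span ⟨(a, b), hfoot, rfl⟩)
          rw [mem_footprint] at hfoot
          dsimp only at hfoot
          by_cases haμ : μ ≤ a
          · obtain ⟨u, rfl⟩ := Nat.exists_eq_add_of_le haμ
            obtain ⟨v, rfl⟩ := Nat.exists_eq_add_of_le (show lam ≤ b by omega)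
            exact hmulf u v hab.le
          · obtain ⟨v, rfl⟩ := Nat.exists_eq_add_of_le (show lam + q ≤ b by omega)
            obtain ⟨u, hu⟩ := Nat.exists_eq_add_of_le (show μ ≤ a + (q + 1) by omega)
            have h1 : monoXY F (a + (q + 1)) (lam + v) ∈ W := by
              rw [hu]
              refine hmulf u v ?_
              rw [← hu]
              nlinarith
            have h2 : monoXY F a (lam + v + 1) ∈ W := ihk _ (by nlinarith) _ _ rfl
            have h3 := monoXY_reduce (F := F) q a (lam + v)
            rw [show lam + q + v = lam + v + q by ring, show monoXY F a (lam + v + q) =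
              monoXY F (a + (q + 1)) (lam + v) - monoXY F a (lam + v) * Hpoly F q -
                monoXY F a (lam + v + 1) by rw [h3]; ring]
            exact sub_mem (sub_mem h1 (hJW _ (Ideal.mul_mem_left _ _ hHJ))) h2
        · obtain ⟨a, rfl⟩ := Nat.exists_eq_add_of_le' (show q + 1 ≤ a by omega)
          rw [monoXY_reduce]
          exact add_mem (add_mem (hJW _ (Ideal.mul_mem_left _ _ hHJ))
            (iha a (by omega) _ (by nlinarith))) (ihk _ (by nlinarith) _ _ rfl)
  have hg : g ∈ W := by
    rw [eq_sum_smul_monoXY g]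
    exact Submodule.sum_mem _ fun e _ => Submodule.smul_mem _ _ (hmono _ _ _ rfl)
  obtain ⟨h, hh, n, hn, rfl⟩ := Submodule.mem_sup.1 hg
  obtain ⟨c, hc, rfl⟩ := (Finsupp.mem_span_image_iff_linearCombination F).1 hn
  refine ⟨c, ?_⟩
  rw [Finsupp.linearCombination_apply, Finsupp.sum_of_support_subset c
    ((Finsupp.mem_supported F c).1 hc) _ (by simp), add_sub_cancel_right]
  exact hh

/-- A functional vanishing on `⟨H, f⟩` that reads off the component in the top weight of the
footprint. -/
theorem exists_top_functional {q μ lam N : ℕ} (hq : 2 ≤ q) (hμ : μ ≤ q)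
    (hN : N + q + 1 = μ * q + lam * (q + 1) + q * q) (hlam : 0 < μ * q + lam * (q + 1))
    {f : MvPolynomial (Fin 2) F} (hlm : IsLMwith precOrd f μ lam) :
    ∃ φ : MvPolynomial (Fin 2) F →ₗ[F] F, (∀ h ∈ Ideal.span {Hpoly F q, f}, φ h = 0) ∧
      (∀ h ∈ weightLE F q N, coeffSum F q N h = 0 → φ h = 0) ∧
      ∀ g, (∀ r s, φ (g * monoXY F r s) = 0) → g ∈ Ideal.span {Hpoly F q, f} := by
  obtain ⟨p, hp⟩ := Finset.card_pos.1 ((card_footprint q μ lam).symm ▸ hlam)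
  obtain ⟨r₀, s₀, h₀⟩ := exists_complement_of_mem_footprint hμ hN hp
  set M := monoXY F (p.1 + r₀) (p.2 + s₀)
  have hMw : (p.1 + r₀) * q + (p.2 + s₀) * (q + 1) = N := by rw [← h₀]; ring
  have hM : M ∈ weightLE F q N := monoXY_mem_weightLE hMw.le
  have hM1 : coeffSum F q N M = 1 := coeffSum_monoXY hMw
  have hnot : M ∉ (Ideal.span {Hpoly F q, f}).restrictScalars F ⊔
      (weightLE F q N ⊓ LinearMap.ker (coeffSum F q N)) := by
    intro hmem
    obtain ⟨j, hj, l, ⟨hl, hl0⟩, hjl⟩ := Submodule.mem_sup.1 hmem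
    have hj' : j = M - l := by rw [← hjl]; ring
    have := coeffSum_eq_zero_of_mem_span hq hμ hN hlm hj (by rw [hj']; exact sub_mem hM hl)
    rw [hj', map_sub, hM1, LinearMap.mem_ker.1 hl0, sub_zero] at this
    exact one_ne_zero this
  obtain ⟨φ, hφM, hφ⟩ := Submodule.exists_le_ker_of_notMem hnot
  have hφJ : ∀ h ∈ Ideal.span {Hpoly F q, f}, φ h = 0 := fun h hh =>
    hφ (Submodule.mem_sup_left hh)
  have hφ0 : ∀ h ∈ weightLE F q N, coeffSum F q N h = 0 → φ h = 0 := fun h hh h0 =>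
    hφ (Submodule.mem_sup_right ⟨hh, h0⟩)
  refine ⟨φ, hφJ, hφ0, fun g hg => ?_⟩
  obtain ⟨c, hc⟩ := exists_footprint_sum_sub_mem hq hμ hlm g
  by_cases hne : ∃ i ∈ footprint q μ lam, c i ≠ 0
  · exfalso
    obtain ⟨r, s, hw, hs⟩ := exists_mul_monoXY_leading hμ hN hne
    set t := ∑ j ∈ footprint q μ lam, c j • monoXY F j.1 j.2
    have h1 : φ (t * monoXY F r s) = 0 := by
      have := hφJ _ (Ideal.mul_mem_right (monoXY F r s) _ hc)
      rw [sub_mul, map_sub, hg, zero_sub, neg_eq_zero] at this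
      exact this
    have h2 := hφ0 (t * monoXY F r s - coeffSum F q N (t * monoXY F r s) • M)
      (sub_mem hw (Submodule.smul_mem _ _ hM)) (by simp [hM1])
    rw [map_sub, h1, map_smul, zero_sub, neg_eq_zero, smul_eq_mul] at h2
    exact (mul_ne_zero hs hφM) h2
  · push Not at hne
    rwa [Finset.sum_eq_zero (fun j hj => by rw [hne j hj, zero_smul]), sub_zero] at hc

end Footprint

section Points

variable {F : Type} [Field F]

theorem evalPt_sub (p : F × F) (g h : MvPolynomial (Fin 2) F) :
    evalPt p (g - h) = evalPt p g - evalPt p h := map_sub _ _ _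

theorem evalPt_mul (p : F × F) (g h : MvPolynomial (Fin 2) F) :
    evalPt p (g * h) = evalPt p g * evalPt p h := map_mul _ _ _

theorem evalPt_smul (p : F × F) (c : F) (h : MvPolynomial (Fin 2) F) :
    evalPt p (c • h) = c * evalPt p h := by
  simp [evalPt]

theorem evalPt_sum {ι : Type*} (p : F × F) (s : Finset ι) (h : ι → MvPolynomial (Fin 2) F) :
    evalPt p (∑ i ∈ s, h i) = ∑ i ∈ s, evalPt p (h i) := map_sum _ _ _

theorem evalPt_Hpoly (q : ℕ) (p : F × F) :
    evalPt p (Hpoly F q) = p.1 ^ (q + 1) - p.2 ^ q - p.2 := by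
  simp [evalPt, Hpoly]

variable [Fintype F]

theorem evalPt_X_pow_card_sub (p : F × F) (i : Fin 2) :
    evalPt p ((X i : MvPolynomial (Fin 2) F) ^ Fintype.card F - X i) = 0 := by
  simp [evalPt, FiniteField.pow_card]

theorem prod_X_sub_C_univ (i : Fin 2) :
    ∏ r : F, ((X i : MvPolynomial (Fin 2) F) - C r) = X i ^ Fintype.card F - X i := by
  have h : ∏ r : F, (Polynomial.X - Polynomial.C r) =
      (Polynomial.X ^ Fintype.card F - Polynomial.X : Polynomial F) := by
    have hr := FiniteField.roots_X_pow_card_sub_X F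
    have hd := FiniteField.X_pow_card_sub_X_natDegree_eq F (Fintype.one_lt_card (α := F))
    have := Polynomial.prod_multiset_X_sub_C_of_monic_of_roots_card_eq
      (p := (Polynomial.X ^ Fintype.card F - Polynomial.X : Polynomial F))
      (Polynomial.monic_X_pow_sub (by
        rw [Polynomial.degree_X]
        exact_mod_cast Fintype.one_lt_card (α := F)))
      (by rw [hr, hd]; rfl)
    rwa [hr] at this
  have := congrArg (Polynomial.aeval (X i : MvPolynomial (Fin 2) F)) h
  simpa [map_prod, algebraMap_eq] using this

/-- A polynomial vanishing on the whole plane lies in any ideal containing the field equations. -/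
theorem mem_of_evalPt_eq_zero {J : Ideal (MvPolynomial (Fin 2) F)}
    (hJ : ∀ i, (X i : MvPolynomial (Fin 2) F) ^ Fintype.card F - X i ∈ J)
    {g : MvPolynomial (Fin 2) F} (hg : ∀ p, evalPt p g = 0) : g ∈ J := by
  obtain ⟨h, -, hh⟩ := combinatorial_nullstellensatz_exists_linearCombination
    (fun _ => Finset.univ) (fun _ => Finset.univ_nonempty) g (fun x _ => by
      have := hg (x 0, x 1)
      rw [evalPt] at this
      rwa [show x = ![x 0, x 1] by ext i; fin_cases i <;> rfl])
  rw [hh, Finsupp.linearCombination_apply]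
  refine Ideal.sum_mem _ fun i _ => Ideal.mul_mem_left _ _ ?_
  rw [prod_X_sub_C_univ]
  exact hJ i

/-- The polynomial taking the value `1` at `p` and `0` at all other points. -/
noncomputable def pointIndicator (p : F × F) : MvPolynomial (Fin 2) F := indicator ![p.1, p.2]

theorem evalPt_pointIndicator_self (p : F × F) : evalPt p (pointIndicator p) = 1 :=
  eval_indicator_apply_eq_one _

theorem evalPt_pointIndicator_of_ne {p p' : F × F} (h : p ≠ p') :
    evalPt p (pointIndicator p') = 0 := by
  refine eval_indicator_apply_eq_zero _ _ fun h' => h ?_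
  exact Prod.ext (congrFun h' 0) (congrFun h' 1)

/-- An ideal containing the field equations is the vanishing ideal of its zero set. -/
theorem eq_vanIdeal_of_fieldEq_mem {J : Ideal (MvPolynomial (Fin 2) F)}
    (hJ : ∀ i, (X i : MvPolynomial (Fin 2) F) ^ Fintype.card F - X i ∈ J) :
    J = vanIdeal F {p | ∀ h ∈ J, evalPt p h = 0} := by
  classical
  refine le_antisymm (fun h hh p hp => hp h hh) fun g hg => ?_
  have hex : ∀ p : F × F, ∃ j ∈ J, evalPt p j = evalPt p g := by
    intro p
    by_cases hp : ∀ h ∈ J, evalPt p h = 0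
    · exact ⟨0, J.zero_mem, by rw [hg p hp, hp 0 J.zero_mem]⟩
    · push Not at hp
      obtain ⟨h, hh, h0⟩ := hp
      refine ⟨(evalPt p g / evalPt p h) • h, Submodule.smul_of_tower_mem _ _ hh, ?_⟩
      rw [evalPt_smul, div_mul_cancel₀ _ h0]
  choose j hjJ hj using hex
  have h1 : g - ∑ p, j p * pointIndicator p ∈ J := by
    refine mem_of_evalPt_eq_zero hJ fun p => ?_
    rw [evalPt_sub, evalPt_sum, Finset.sum_eq_single p, evalPt_mul, evalPt_pointIndicator_self,
      hj, mul_one, sub_self]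
    · intro b _ hb
      rw [evalPt_mul, evalPt_pointIndicator_of_ne hb.symm, mul_zero]
    · simp
  have := add_mem h1 (J.sum_mem (t := Finset.univ) (f := fun p => j p * pointIndicator p)
    fun p _ => J.mul_mem_right _ (hjJ p))
  rwa [sub_add_cancel] at this

/-- The number of points of `D` is the size of the footprint. -/
theorem ncard_eq_of_span_eq_vanIdeal {q μ lam : ℕ} (hq : 2 ≤ q) (hμ : μ ≤ q)
    {f : MvPolynomial (Fin 2) F} (hlm : IsLMwith precOrd f μ lam) {D : Set (F × F)}
    (hD : Ideal.span {Hpoly F q, f} = vanIdeal F D) :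
    D.ncard = μ * q + lam * (q + 1) := by
  classical
  let ev : (footprint q μ lam → F) →ₗ[F] (D → F) :=
    { toFun := fun c p => ∑ j, c j * (p.1.1 ^ j.1.1 * p.1.2 ^ j.1.2)
      map_add' := fun c c' => by
        ext p
        simp [add_mul, Finset.sum_add_distrib]
      map_smul' := fun a c => by
        ext p
        simp [Finset.mul_sum, mul_assoc] }
  have hev : ∀ (c : ℕ × ℕ → F) (p : D), ev (fun j => c j) p =
      evalPt p.1 (∑ j ∈ footprint q μ lam, c j • monoXY F j.1 j.2) := by
    intro c p
    simp only [evalPt_sum, evalPt_smul, evalPt_monoXY]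
    exact Finset.sum_coe_sort (footprint q μ lam)
      (fun j => c j * (p.1.1 ^ j.1 * p.1.2 ^ j.2))
  have hinj : Function.Injective ev := by
    rw [injective_iff_map_eq_zero]
    intro c hc
    let c' : ℕ × ℕ → F := fun j => if hj : j ∈ footprint q μ lam then c ⟨j, hj⟩ else 0
    have hcc : (fun j : footprint q μ lam => c' j) = c := by
      ext j
      simp [c']
    have := eq_zero_of_footprint_sum_mem hq hμ hlm (c := c') (by
      rw [hD]
      intro p hp
      rw [← hev c' ⟨p, hp⟩, hcc, hc]
      rfl)
    rw [← hcc]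
    ext j
    exact this j j.2
  have hsurj : Function.Surjective ev := by
    intro v
    let g : MvPolynomial (Fin 2) F := ∑ p : D, v p • pointIndicator p.1
    have hg : ∀ p : D, evalPt p.1 g = v p := by
      intro p
      simp only [g, evalPt_sum, evalPt_smul]
      rw [Finset.sum_eq_single p, evalPt_pointIndicator_self, mul_one]
      · intro b _ hb
        rw [evalPt_pointIndicator_of_ne (fun h => hb (Subtype.ext h.symm)), mul_zero]
      · simp
    obtain ⟨c, hc⟩ := exists_footprint_sum_sub_mem hq hμ hlm g
    rw [hD] at hc
    refine ⟨fun j => c j, funext fun p => ?_⟩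
    have := hc p.1 p.2
    rw [evalPt_sub, sub_eq_zero, hg] at this
    rw [hev, this]
  have := (LinearEquiv.ofBijective ev ⟨hinj, hsurj⟩).finrank_eq
  rw [Module.finrank_pi, Module.finrank_pi, Fintype.card_coe, card_footprint] at this
  rw [this, ← Nat.card_eq_fintype_card, Nat.card_coe_set_eq]

/-- The point set cut out by `⟨H, f⟩` is the support of a codeword. -/
theorem exists_codeword_of_span_eq_vanIdeal {q μ lam m : ℕ} (hq : 2 ≤ q) (hμ : μ ≤ q)
    (hm : m + 1 + q + 1 = μ * q + lam * (q + 1) + q * q) (hlam : 0 < μ * q + lam * (q + 1))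
    {P : Fin (q ^ 3) → F × F} (hPinj : Function.Injective P) (hPrange : Set.range P = Eset F q)
    {f : MvPolynomial (Fin 2) F} (hlm : IsLMwith precOrd f μ lam) {D : Set (F × F)}
    (hDE : D ⊆ Eset F q) (hD : Ideal.span {Hpoly F q, f} = vanIdeal F D) :
    ∃ c ∈ codeSet F q m P, suppPts P c = D := by
  obtain ⟨φ, hφJ, hφ0, hφ⟩ := exists_top_functional hq hμ hm hlam hlm
  rw [hD] at hφJ hφ
  have hmul : ∀ p h, pointIndicator p * h - evalPt p h • pointIndicator p ∈ vanIdeal F D := by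
    intro p h p' _
    rw [evalPt_sub, evalPt_mul, evalPt_smul]
    by_cases hpp : p' = p
    · rw [hpp]; ring
    · rw [evalPt_pointIndicator_of_ne hpp]; ring
  have hsupp : ∀ p, φ (pointIndicator p) ≠ 0 ↔ p ∈ D := by
    intro p
    constructor
    · contrapose!
      intro hp
      exact hφJ _ fun p' hp' => evalPt_pointIndicator_of_ne fun h => hp (h ▸ hp')
    · intro hp h0
      have := hφ (pointIndicator p) (fun r s => by
        have := hφJ _ (hmul p (monoXY F r s))
        rwa [map_sub, map_smul, h0, smul_zero, sub_zero] at this) p hp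
      rw [evalPt_pointIndicator_self] at this
      exact one_ne_zero this
  refine ⟨fun i => φ (pointIndicator (P i)), fun r s hrs => ?_, ?_⟩
  · have hmem : monoXY F r s -
        ∑ i, ((P i).1 ^ r * (P i).2 ^ s) • pointIndicator (P i) ∈ vanIdeal F D := by
      intro p hp
      obtain ⟨i, rfl⟩ : p ∈ Set.range P := hPrange ▸ hDE hp
      rw [evalPt_sub, evalPt_sum, evalPt_monoXY, Finset.sum_eq_single i, evalPt_smul,
        evalPt_pointIndicator_self, mul_one, sub_self]
      · intro b _ hb
        rw [evalPt_smul, evalPt_pointIndicator_of_ne (fun h => hb (hPinj h.symm)), mul_zero]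
      · simp
    have h1 := hφJ _ hmem
    have h2 : φ (monoXY F r s) = 0 := hφ0 _ (monoXY_mem_weightLE (hrs.trans m.le_succ))
      (coeffSum_of_mem_weightLE m.lt_succ_self (monoXY_mem_weightLE hrs))
    rw [map_sub, h2, zero_sub, neg_eq_zero, map_sum] at h1
    rw [← h1]
    exact Finset.sum_congr rfl fun i _ => by rw [map_smul, smul_eq_mul, mul_comm]
  · ext p
    constructor
    · rintro ⟨i, hi, rfl⟩
      exact (hsupp _).1 hi
    · intro hp
      obtain ⟨i, rfl⟩ : p ∈ Set.range P := hPrange ▸ hDE hp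
      exact ⟨i, (hsupp _).2 hp, rfl⟩

end Points

theorem stmt_19 (q : ℕ) (hq2 : 2 ≤ q) (hq : IsPrimePow q)
    (F : Type) [Field F] [Fintype F] (hF : Fintype.card F = q ^ 2)
    (P : Fin (q ^ 3) → F × F) (hPinj : Function.Injective P)
    (hPrange : Set.range P = Eset F q)
    (m μ lam d : ℕ) (hm1 : 2 * q ^ 2 - 2 * q - 2 ≤ m) (hm2 : m ≤ q ^ 3 + q * (q - 1) - 2)
    (hB : ∃ p ∈ Bset q, p.1 * q + p.2 * (q + 1) = m + 1)
    (hμ : μ ≤ q) (hmeq : m = μ * q + (lam + q - 2) * (q + 1))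
    (hd : d = μ * q + lam * (q + 1))
    (f : MvPolynomial (Fin 2) F) (hlm : IsLMwith precOrd f μ lam) :
    ((X 0 : MvPolynomial (Fin 2) F) ^ (q ^ 2) - X 0 ∈ Ideal.span {Hpoly F q, f} ∧
        (X 1 : MvPolynomial (Fin 2) F) ^ (q ^ 2) - X 1 ∈ Ideal.span {Hpoly F q, f}) ↔
      ∃ D : Set (F × F), D ⊆ Eset F q ∧
        Ideal.span {Hpoly F q, f} = vanIdeal F D ∧ D.ncard = d ∧
        ∃ c ∈ codeSet F q m P, c ≠ 0 ∧ suppPts P c = D ∧ wt c = d := by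
  constructor
  · rintro ⟨hx, hy⟩
    have hm : m + 1 + q + 1 = μ * q + lam * (q + 1) + q * q := by
      obtain ⟨t, rfl⟩ := Nat.exists_eq_add_of_le' hq2
      rw [hmeq, show lam + (t + 2) - 2 = lam + t by omega]
      ring
    have hlam : 0 < μ * q + lam * (q + 1) := by
      by_contra! h0
      have : 2 * q ^ 2 - 2 * q ≤ q * q - q := by omega
      have : q * q = q ^ 2 := by ring
      have : 2 * q ≤ q ^ 2 := by nlinarith
      omega
    have hJ : ∀ i, (X i : MvPolynomial (Fin 2) F) ^ Fintype.card F - X i ∈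
        Ideal.span {Hpoly F q, f} := by
      rw [hF]
      exact Fin.forall_fin_two.2 ⟨hx, hy⟩
    have hD := eq_vanIdeal_of_fieldEq_mem hJ
    set D : Set (F × F) := {p | ∀ h ∈ Ideal.span {Hpoly F q, f}, evalPt p h = 0}
    have hDE : D ⊆ Eset F q := by
      intro p hp
      have h := hp (Hpoly F q) (Ideal.subset_span (by simp))
      rw [evalPt_Hpoly, sub_sub, sub_eq_zero] at h
      exact h
    have hcard : D.ncard = d := by rw [hd, ncard_eq_of_span_eq_vanIdeal hq2 hμ hlm hD]
    obtain ⟨c, hc, hcD⟩ := exists_codeword_of_span_eq_vanIdeal hq2 hμ hm hlam hPinj hPrange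
      hlm hDE hD
    have hwt : wt c = d := by
      rw [← hcard, ← hcD]
      exact (Set.ncard_image_of_injective _ hPinj).symm
    refine ⟨D, hDE, hD, hcard, c, hc, ?_, hcD, hwt⟩
    rintro rfl
    rw [hd] at hwt
    simp [wt] at hwt
    omega
  · rintro ⟨D, -, hD, -⟩
    rw [hD, ← hF]
    exact ⟨fun p _ => evalPt_X_pow_card_sub p 0, fun p _ => evalPt_X_pow_card_sub p 1⟩
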